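/- Let C be a set of embedded coalitions of a finite set N containing the grand coalition or such that the induced game has v(N;{∅,N})=1, and suppose no two distinct elements of C are comparable under ⊑ (an antichain). Then there exists a unique simple game in partition function form v whose set of minimal winning embedded coalitions equals C. -/

import Mathlib

open scoped Classical

/-- A partition of the finite set `α` (the empty set is allowed/required as a block). -/
def IsPartition {α : Type*} [Fintype α] [DecidableEq α] (P : Finset (Finset α)) : Prop :=
  (∅ : Finset α) ∈ P ∧
  (∀ S ∈ P, ∀ T ∈ P, S ≠ T → Disjoint S T) ∧
  P.sup id = Finset.univ

/-- An embedded coalition: a partition `P` together with an active block `S ∈ P`. -/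
structure EC (α : Type*) [Fintype α] [DecidableEq α] where
  P : Finset (Finset α)
  S : Finset α
  memP : S ∈ P
  part : IsPartition P

/-- Inclusion of embedded coalitions: `(S;P) ⊑ (T;Q)` iff `S ⊆ T` and every block of
`Q` other than `T` is contained in some block of `P`. -/
def ECle {α : Type*} [Fintype α] [DecidableEq α] (a b : EC α) : Prop :=
  a.S ⊆ b.S ∧ ∀ T' ∈ b.P.erase b.S, ∃ S' ∈ a.P, T' ⊆ S'

/-- A simple game in partition function form: `{0,1}`-valued, the grand embedded
coalition wins, and monotone w.r.t. `⊑`. -/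
def IsSimplePFF {α : Type*} [Fintype α] [DecidableEq α] (v : EC α → ℝ) : Prop :=
  (∀ a : EC α, v a = 0 ∨ v a = 1) ∧
  (∀ b : EC α, b.S = Finset.univ → b.P = {∅, Finset.univ} → v b = 1) ∧
  (∀ a b : EC α, ECle a b → v a ≤ v b)

/-- Minimal winning embedded coalition: winning, and every proper `⊑`-subset loses. -/
def IsMWEC {α : Type*} [Fintype α] [DecidableEq α] (v : EC α → ℝ) (a : EC α) : Prop :=
  v a = 1 ∧ ∀ b : EC α, ECle b a → b ≠ a → v b = 0

section

variable {α : Type*} [Fintype α] [DecidableEq α]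

theorem EC.ext_of_eq {a b : EC α} (hS : a.S = b.S) (hP : a.P = b.P) : a = b := by
  cases a; cases b; cases hS; cases hP; rfl

instance EC.finite : Finite (EC α) :=
  Finite.of_injective (fun a : EC α => (a.S, a.P)) fun _ _ h =>
    EC.ext_of_eq (congrArg Prod.fst h) (congrArg Prod.snd h)

theorem IsPartition.eq_of_subset {P : Finset (Finset α)} (hP : IsPartition P)
    {S T : Finset α} (hS : S ∈ P) (hT : T ∈ P) (hST : S ⊆ T) (hne : S ≠ ∅) : S = T := by
  by_contra h
  exact hne (Finset.disjoint_self_iff_empty S |>.1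
    ((hP.2.1 S hS T hT h).mono_right hST))

theorem ECle.refl (a : EC α) : ECle a a :=
  ⟨Finset.Subset.refl _, fun T hT => ⟨T, Finset.mem_of_mem_erase hT, Finset.Subset.refl _⟩⟩

theorem ECle.trans {a b c : EC α} (hab : ECle a b) (hbc : ECle b c) : ECle a c := by
  refine ⟨hab.1.trans hbc.1, fun T hT => ?_⟩
  obtain ⟨U, hU, hTU⟩ := hbc.2 T hT
  by_cases hUS : U = b.S
  · have hTc : T ⊆ c.S := hTU.trans (hUS ▸ hbc.1)
    by_cases hT0 : T = ∅
    · exact ⟨∅, a.part.1, hT0 ▸ Finset.Subset.refl _⟩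
    · exact absurd (c.part.eq_of_subset (Finset.mem_of_mem_erase hT) c.memP hTc hT0)
        (Finset.ne_of_mem_erase hT)
  · obtain ⟨V, hV, hUV⟩ := hab.2 U (Finset.mem_erase.2 ⟨hUS, hU⟩)
    exact ⟨V, hV, hTU.trans hUV⟩

theorem ECle.blocks_subset {a b : EC α} (hab : ECle a b) (hba : ECle b a) : b.P ⊆ a.P := by
  have hS : a.S = b.S := hab.1.antisymm hba.1
  intro T hT
  by_cases hTS : T = b.S
  · rw [hTS, ← hS]
    exact a.memP
  by_cases hT0 : T = ∅
  · exact hT0 ▸ a.part.1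
  obtain ⟨U, hU, hTU⟩ := hab.2 T (Finset.mem_erase.2 ⟨hTS, hT⟩)
  have hUS : U ≠ a.S := by
    rintro rfl
    exact hTS (b.part.eq_of_subset hT b.memP (hS ▸ hTU) hT0)
  obtain ⟨V, hV, hUV⟩ := hba.2 U (Finset.mem_erase.2 ⟨hUS, hU⟩)
  have hTV : T = V := b.part.eq_of_subset hT hV (hTU.trans hUV) hT0
  have hTU' : T = U := hTU.antisymm (hTV ▸ hUV)
  exact hTU' ▸ hU

theorem ECle.antisymm {a b : EC α} (hab : ECle a b) (hba : ECle b a) : a = b :=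
  EC.ext_of_eq (hab.1.antisymm hba.1) ((hba.blocks_subset hab).antisymm (hab.blocks_subset hba))

instance EC.partialOrder : PartialOrder (EC α) where
  le := ECle
  le_refl := ECle.refl
  le_trans _ _ _ := ECle.trans
  le_antisymm _ _ := ECle.antisymm

theorem IsSimplePFF.exists_isMWEC_le {v : EC α → ℝ} (hv : IsSimplePFF v) {a : EC α}
    (ha : v a = 1) : ∃ c, IsMWEC v c ∧ ECle c a := by
  obtain ⟨c, hca, hc⟩ := (Set.toFinite {b : EC α | v b = 1}).exists_le_minimal ha
  refine ⟨c, ⟨hc.prop, fun b hbc hne => (hv.1 b).resolve_right fun hb => hne ?_⟩, hca⟩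
  exact hbc.antisymm (hc.le_of_le hb hbc)

theorem IsSimplePFF.eq_one_iff {v : EC α → ℝ} (hv : IsSimplePFF v) (a : EC α) :
    v a = 1 ↔ ∃ c ∈ {c : EC α | IsMWEC v c}, ECle c a := by
  refine ⟨fun ha => hv.exists_isMWEC_le ha, ?_⟩
  rintro ⟨c, hc, hca⟩
  refine (hv.1 a).resolve_left fun h0 => ?_
  have := hv.2.2 c a hca
  rw [hc.1, h0] at this
  exact absurd this (by norm_num)

/-- The game in which the winning embedded coalitions are those containing a member of `C`. -/
noncomputable def inducedGame (C : Set (EC α)) (a : EC α) : ℝ :=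
  if ∃ c ∈ C, ECle c a then 1 else 0

theorem inducedGame_eq_one_iff {C : Set (EC α)} {a : EC α} :
    inducedGame C a = 1 ↔ ∃ c ∈ C, ECle c a := by
  simp [inducedGame]

theorem inducedGame_eq_zero_iff {C : Set (EC α)} {a : EC α} :
    inducedGame C a = 0 ↔ ¬ ∃ c ∈ C, ECle c a := by
  simp [inducedGame]

theorem isSimplePFF_inducedGame {C : Set (EC α)}
    (hgrand : ∀ b : EC α, b.S = Finset.univ → b.P = {∅, Finset.univ} →
      ∃ a ∈ C, ECle a b) : IsSimplePFF (inducedGame C) := by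
  have h01 (a : EC α) : inducedGame C a = 0 ∨ inducedGame C a = 1 := by
    rw [inducedGame_eq_zero_iff, inducedGame_eq_one_iff]
    exact (em _).symm
  refine ⟨h01, fun b hS hP => inducedGame_eq_one_iff.2 (hgrand b hS hP), fun a b hab => ?_⟩
  rcases h01 a with ha | ha
  · rcases h01 b with hb | hb <;> simp [ha, hb]
  · obtain ⟨c, hc, hca⟩ := inducedGame_eq_one_iff.1 ha
    exact (ha.trans (inducedGame_eq_one_iff.2 ⟨c, hc, hca.trans hab⟩).symm).le

theorem setOf_isMWEC_inducedGame {C : Set (EC α)}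
    (hanti : ∀ a ∈ C, ∀ b ∈ C, a ≠ b → ¬ ECle a b) :
    {a : EC α | IsMWEC (inducedGame C) a} = C := by
  ext a
  constructor
  · rintro ⟨h1, hmin⟩
    obtain ⟨c, hc, hca⟩ := inducedGame_eq_one_iff.1 h1
    by_cases hne : c = a
    · exact hne ▸ hc
    · exact absurd ⟨c, hc, ECle.refl c⟩ (inducedGame_eq_zero_iff.1 (hmin c hca hne))
  · intro ha
    refine ⟨inducedGame_eq_one_iff.2 ⟨a, ha, ECle.refl a⟩, fun b hba hne => ?_⟩
    rw [inducedGame_eq_zero_iff]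
    rintro ⟨c, hc, hcb⟩
    by_cases hca : c = a
    · exact hne (hba.antisymm (hca ▸ hcb))
    · exact hanti c hc a ha hca (hcb.trans hba)

end

/-- An antichain `C` of embedded coalitions (whose induced game makes the grand
embedded coalition winning) is the set of minimal winning embedded coalitions of a
unique simple game in partition function form. -/
theorem exists_unique_simplePFF_of_antichain {α : Type*} [Fintype α] [DecidableEq α]
    (C : Set (EC α))
    (hgrand : ∀ b : EC α, b.S = Finset.univ → b.P = {∅, Finset.univ} →
      ∃ a ∈ C, ECle a b)
    (hanti : ∀ a ∈ C, ∀ b ∈ C, a ≠ b → ¬ ECle a b) :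
    ∃! v : EC α → ℝ, IsSimplePFF v ∧ {a : EC α | IsMWEC v a} = C := by
  refine ⟨inducedGame C, ⟨isSimplePFF_inducedGame hgrand, setOf_isMWEC_inducedGame hanti⟩, ?_⟩
  rintro v ⟨hv, rfl⟩
  funext a
  by_cases h : v a = 1
  · rw [h, inducedGame_eq_one_iff.2 ((hv.eq_one_iff a).1 h)]
  · rw [(hv.1 a).resolve_right h, inducedGame_eq_zero_iff.2 (mt (hv.eq_one_iff a).2 h)]
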